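/- There exists n₀ such that if G is an oriented graph on n ≥ n₀ vertices with minimum semidegree δ±(G) ≥ n/4 + 1/2 that contains no directed cycle of length 6, then G contains no directed 4-cycle with a chord; that is, there do not exist four distinct vertices a, b, c, d of G with edges ab, bc, cd, da and the additional edge ac. -/

import Mathlib

/-- The outdegree of a vertex `v` in the directed graph with edge relation `E`. -/
noncomputable def outDeg {n : ℕ} (E : Fin n → Fin n → Prop) (v : Fin n) : ℕ :=
  {w | E v w}.ncard

/-- The indegree of a vertex `v` in the directed graph with edge relation `E`. -/
noncomputable def inDeg {n : ℕ} (E : Fin n → Fin n → Prop) (v : Fin n) : ℕ :=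
  {w | E w v}.ncard

/-- The semidegree of a vertex: the minimum of its outdegree and indegree. -/
noncomputable def semiDeg {n : ℕ} (E : Fin n → Fin n → Prop) (v : Fin n) : ℕ :=
  min (outDeg E v) (inDeg E v)

/-- `E` is an oriented graph: no loops and no pair of opposite edges. -/
def Oriented {n : ℕ} (E : Fin n → Fin n → Prop) : Prop :=
  (∀ v, ¬ E v v) ∧ (∀ u v, E u v → ¬ E v u)

/-- The graph contains a directed cycle of length exactly `t`:
`t` distinct vertices cyclically joined by edges. -/
def HasDiCycle {n : ℕ} (E : Fin n → Fin n → Prop) (t : ℕ) : Prop :=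
  ∃ v : ZMod t → Fin n, Function.Injective v ∧ ∀ i, E (v i) (v (i + 1))

/-- The graph contains a closed directed walk of length `t` (vertices may repeat). -/
def HasClosedWalk {n : ℕ} (E : Fin n → Fin n → Prop) (t : ℕ) : Prop :=
  ∃ w : ℕ → Fin n, w 0 = w t ∧ ∀ i < t, E (w i) (w (i + 1))

/-- There is a directed path of length `t` from `x` to `y` (all vertices distinct). -/
def HasPath {n : ℕ} (E : Fin n → Fin n → Prop) (x y : Fin n) (t : ℕ) : Prop :=
  ∃ u : Fin (t + 1) → Fin n, Function.Injective u ∧ u 0 = x ∧ u (Fin.last t) = y ∧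
    ∀ i : Fin t, E (u i.castSucc) (u i.succ)

/-- The graph contains an `s`-shortcut: a directed path `v₀ v₁ ⋯ v_s` on distinct
vertices together with the additional edge `v₀ v_s`. -/
def HasShortcut {n : ℕ} (E : Fin n → Fin n → Prop) (s : ℕ) : Prop :=
  ∃ v : Fin (s + 1) → Fin n, Function.Injective v ∧
    (∀ i : Fin s, E (v i.castSucc) (v i.succ)) ∧ E (v 0) (v (Fin.last s))

/-- The graph is homomorphic to the directed cycle `C_k`. -/
def HomToCycle {n : ℕ} (E : Fin n → Fin n → Prop) (k : ℕ) : Prop :=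
  ∃ f : Fin n → ZMod k, ∀ u v, E u v → f v = f u + 1


open Finset

section

variable {V : Type*} [DecidableEq V]

lemma sum_card_le_card_biUnion_add {ι : Type*} [DecidableEq ι] (s : Finset ι) (W : ι → Finset V)
    (h : ∀ i ∈ s, ∀ j ∈ s, i ≠ j → #(W i ∩ W j) ≤ 1) :
    ∑ i ∈ s, #(W i) ≤ #(s.biUnion W) + #s ^ 2 := by
  induction s using Finset.induction_on with
  | empty => simp
  | insert i s hi ih =>
    have ih' := ih fun a ha b hb => h a (mem_insert_of_mem ha) b (mem_insert_of_mem hb)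
    rw [sum_insert hi, biUnion_insert, card_insert_of_notMem hi]
    have h1 := card_union_add_card_inter (W i) (s.biUnion W)
    have h2 : #(W i ∩ s.biUnion W) ≤ #s := by
      rw [inter_biUnion]
      refine card_biUnion_le.trans ?_
      calc ∑ j ∈ s, #(W i ∩ W j) ≤ ∑ _j ∈ s, 1 := sum_le_sum fun j hj =>
            h i (mem_insert_self _ _) j (mem_insert_of_mem hj) (by rintro rfl; exact hi hj)
        _ = #s := by simp
    nlinarith

lemma card_add_card_add_card_le (A B C : Finset V) :
    #A + #B + #C ≤ #(A ∪ B ∪ C) + #(A ∩ B) + #(A ∩ C) + #(B ∩ C) := by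
  have h1 := card_union_add_card_inter A B
  have h2 := card_union_add_card_inter (A ∪ B) C
  have h3 := card_union_le (A ∩ C) (B ∩ C)
  rw [← union_inter_distrib_right] at h3
  omega

lemma card_inter_add_card_le (A S T : Finset V) : #(A ∩ S) ≤ #(A ∩ (S \ T)) + #T := by
  refine (card_le_card (t := A ∩ (S \ T) ∪ T) ?_).trans (card_union_le _ _)
  intro x hx
  simp only [mem_union, mem_inter, mem_sdiff] at hx ⊢
  tauto

lemma card_le_card_sdiff_add' (A T : Finset V) : (#A : ℝ) ≤ #(A \ T) + #T := by
  exact_mod_cast card_le_card_sdiff_add_card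

end

lemma card_le_one_of_forall_eq {V : Type*} {s : Finset V} (c : V) (hs : ∀ x ∈ s, x = c) : #s ≤ 1 :=
  card_le_one.2 fun x hx y hy => (hs x hx).trans (hs y hy).symm

open scoped Classical in
/-- The out-neighbourhood of `v`; the in-neighbourhood is `nbhd (flip E) v`. -/
noncomputable def nbhd {V : Type*} [Fintype V] (E : V → V → Prop) (v : V) : Finset V :=
  univ.filter (E v)

/-- Oriented graphs without directed `6`-cycles and with semidegree at least `|V| / 4 + 1 / 2`. -/
structure SparseC6 {V : Type*} [Fintype V] (E : V → V → Prop) : Prop where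
  asymm : ∀ u v, E u v → ¬ E v u
  noC6 : ∀ a b c d e f, a ≠ d → b ≠ e → c ≠ f →
    E a b → E b c → E c d → E d e → E e f → E f a → False
  outdeg : ∀ v, (Fintype.card V : ℝ) / 4 + 1 / 2 ≤ #(nbhd E v)
  indeg : ∀ v, (Fintype.card V : ℝ) / 4 + 1 / 2 ≤ #(nbhd (flip E) v)

section

variable {V : Type*} [Fintype V] {E : V → V → Prop}

lemma mem_nbhd {v w : V} : w ∈ nbhd E v ↔ E v w := by simp [nbhd]

lemma mem_nbhd_flip {v w : V} : w ∈ nbhd (flip E) v ↔ E w v := by simp [nbhd, flip]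

lemma SparseC6.irrefl (h : SparseC6 E) (v : V) : ¬ E v v := fun hv => h.asymm v v hv hv

lemma SparseC6.flip (h : SparseC6 E) : SparseC6 (flip E) where
  asymm u v := h.asymm v u
  noC6 a b c d e f n1 n2 n3 h1 h2 h3 h4 h5 h6 :=
    h.noC6 f e d c b a n3.symm n2.symm n1.symm h5 h4 h3 h2 h1 h6
  outdeg := h.indeg
  indeg := h.outdeg

variable [DecidableEq V]

/-- Outside a bounded set of vertices, every edge lies in few directed triangles. -/
lemma SparseC6.exists_triangle_cover (h : SparseC6 E) (hn : 10 ^ 9 ≤ Fintype.card V) :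
    ∃ H : Finset V, #H ≤ 4000 ∧ ∀ v ∉ H, ∀ x ∉ H, E v x →
      1000 * #(nbhd E x ∩ nbhd (_root_.flip E) v) < Fintype.card V := by
  set n := Fintype.card V with hn'
  let W : V × V → Finset V := fun e => nbhd E e.2 ∩ nbhd (_root_.flip E) e.1
  have key : ∀ k : ℕ, (∃ H : Finset V, #H ≤ 2 * k ∧ ∀ v ∉ H, ∀ x ∉ H, E v x →
      1000 * #(W (v, x)) < n) ∨ ∃ M : Finset (V × V), #M = k ∧
      (∀ e ∈ M, E e.1 e.2 ∧ n ≤ 1000 * #(W e)) ∧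
      ∀ e ∈ M, ∀ f ∈ M, e ≠ f → e.1 ≠ f.1 ∧ e.1 ≠ f.2 ∧ e.2 ≠ f.1 ∧ e.2 ≠ f.2 := by
    intro k
    induction k with
    | zero => exact Or.inr ⟨∅, by simp⟩
    | succ k ih =>
      rcases ih with ⟨H, hH, hc⟩ | ⟨M, hM, he, hd⟩
      · exact Or.inl ⟨H, by omega, hc⟩
      by_cases hc : ∀ v ∉ M.image Prod.fst ∪ M.image Prod.snd,
          ∀ x ∉ M.image Prod.fst ∪ M.image Prod.snd, E v x → 1000 * #(W (v, x)) < n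
      · refine Or.inl ⟨_, ?_, hc⟩
        have h1 := card_union_le (M.image Prod.fst) (M.image Prod.snd)
        have h2 : #(M.image Prod.fst) ≤ #M := card_image_le
        have h3 : #(M.image Prod.snd) ≤ #M := card_image_le
        omega
      · push Not at hc
        obtain ⟨v, hv, x, hx, hvx, hw⟩ := hc
        have hv' : ∀ e ∈ M, v ≠ e.1 ∧ v ≠ e.2 := by
          intro e he
          constructor
          · rintro rfl; exact hv (mem_union_left _ (mem_image_of_mem _ he))
          · rintro rfl; exact hv (mem_union_right _ (mem_image_of_mem _ he))
        have hx' : ∀ e ∈ M, x ≠ e.1 ∧ x ≠ e.2 := by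
          intro e he
          constructor
          · rintro rfl; exact hx (mem_union_left _ (mem_image_of_mem _ he))
          · rintro rfl; exact hx (mem_union_right _ (mem_image_of_mem _ he))
        have hnot : (v, x) ∉ M := fun hm => (hv' _ hm).1 rfl
        refine Or.inr ⟨insert (v, x) M, by rw [card_insert_of_notMem hnot, hM], ?_, ?_⟩
        · intro e hem
          rcases mem_insert.1 hem with rfl | hem
          · exact ⟨hvx, hw⟩
          · exact he e hem
        · intro e hem f hfm hne
          rcases mem_insert.1 hem with rfl | hem <;> rcases mem_insert.1 hfm with rfl | hfm
          · exact absurd rfl hne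
          · exact ⟨(hv' f hfm).1, (hv' f hfm).2, (hx' f hfm).1, (hx' f hfm).2⟩
          · exact ⟨(hv' e hem).1.symm, (hx' e hem).1.symm, (hv' e hem).2.symm, (hx' e hem).2.symm⟩
          · exact hd e hem f hfm hne
  rcases key 2000 with ⟨H, hH, hc⟩ | ⟨M, hM, he, hd⟩
  · exact ⟨H, hH, hc⟩
  exfalso
  have hint : ∀ e ∈ M, ∀ f ∈ M, e ≠ f → #(W e ∩ W f) ≤ 1 := by
    intro e hem f hfm hne
    by_contra hcon
    push Not at hcon
    obtain ⟨w, hw, w', hw', hww⟩ := one_lt_card.1 hcon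
    simp only [W, mem_inter, mem_nbhd] at hw hw'
    obtain ⟨g1, g2, g3, g4⟩ := hd e hem f hfm hne
    exact h.noC6 e.1 e.2 w f.1 f.2 w' g1 g4 hww (he e hem).1 hw.1.1 hw.2.2
      (he f hfm).1 hw'.2.1 hw'.1.2
  have h1 := sum_card_le_card_biUnion_add M W hint
  have h2 : #(M.biUnion W) ≤ n := card_le_univ _
  have h3 : ∑ e ∈ M, n ≤ ∑ e ∈ M, 1000 * #(W e) := sum_le_sum fun e hem => (he e hem).2
  rw [sum_const, ← mul_sum, hM, smul_eq_mul] at h3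
  rw [hM] at h1
  omega

/-- The vertices reachable from `T` in at most `k` steps, each step landing outside `F`. -/
noncomputable def reach (E : V → V → Prop) (F T : Finset V) : ℕ → Finset V
  | 0 => T
  | k + 1 => reach E F T k ∪ ((reach E F T k).biUnion (nbhd E) \ F)

lemma mem_reach_succ {F T : Finset V} {k : ℕ} {w : V} : w ∈ reach E F T (k + 1) ↔
    w ∈ reach E F T k ∨ (∃ u ∈ reach E F T k, E u w) ∧ w ∉ F := by
  simp [reach, mem_nbhd]

lemma reach_subset_succ {F T : Finset V} {k : ℕ} : reach E F T k ⊆ reach E F T (k + 1) :=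
  subset_union_left

lemma reach_mono {F T : Finset V} {k l : ℕ} (hkl : k ≤ l) : reach E F T k ⊆ reach E F T l := by
  induction hkl with
  | refl => exact Subset.refl _
  | step _ ih => exact ih.trans reach_subset_succ

lemma step_mem_reach {F T : Finset V} {k : ℕ} {u w : V} (hu : u ∈ reach E F T k) (huw : E u w)
    (hw : w ∉ F) : w ∈ reach E F T (k + 1) :=
  mem_reach_succ.2 (Or.inr ⟨⟨u, hu, huw⟩, hw⟩)

lemma notMem_of_mem_reach {F T : Finset V} (hT : ∀ t ∈ T, t ∉ F) {k : ℕ} {w : V}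
    (hw : w ∈ reach E F T k) : w ∉ F := by
  induction k with
  | zero => exact hT w hw
  | succ k ih =>
    rcases mem_reach_succ.1 hw with h | h
    · exact ih h
    · exact h.2

lemma exists_mem_reach_singleton {F T : Finset V} {k : ℕ} {w : V} (hw : w ∈ reach E F T k) :
    ∃ t ∈ T, w ∈ reach E F {t} k := by
  induction k generalizing w with
  | zero => exact ⟨w, hw, by simp [reach]⟩
  | succ k ih =>
    rcases mem_reach_succ.1 hw with h | ⟨⟨u, hu, huw⟩, hF⟩
    · obtain ⟨t, ht, h'⟩ := ih h
      exact ⟨t, ht, reach_subset_succ h'⟩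
    · obtain ⟨t, ht, h'⟩ := ih hu
      exact ⟨t, ht, step_mem_reach h' huw hF⟩

lemma reach_add {F T : Finset V} {v s : V} (hv : v ∉ F) {m k : ℕ} (hs : s ∈ reach E F T m)
    (hs' : s ∈ reach (flip E) F {v} k) : v ∈ reach E F T (m + k) := by
  induction k generalizing s m with
  | zero =>
    have : s = v := by simpa [reach] using hs'
    exact this ▸ hs
  | succ k ih =>
    rcases mem_reach_succ.1 hs' with h | ⟨⟨u, hu, hus⟩, -⟩
    · exact reach_mono (by omega) (ih hs h)
    · have huF : u ∉ F := notMem_of_mem_reach (by simpa using hv) hu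
      have := ih (step_mem_reach hs hus huF) hu
      rwa [show m + 1 + k = m + (k + 1) by omega] at this

lemma reach_succ_of_step {F : Finset V} {t t' v : V} (htt : E t t') (ht' : t' ∉ F) {k : ℕ}
    (hv : v ∈ reach E F {t'} k) : v ∈ reach E F {t} (k + 1) := by
  induction k generalizing v with
  | zero =>
    have : v = t' := by simpa [reach] using hv
    subst this
    exact step_mem_reach (by simp [reach]) htt ht'
  | succ k ih =>
    rcases mem_reach_succ.1 hv with h | ⟨⟨u, hu, huv⟩, hF⟩
    · exact reach_subset_succ (ih h)
    · exact step_mem_reach (ih hu) huv hF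

lemma exists_pred_of_mem_reach {F T : Finset V} {k : ℕ} {w : V} (hw : w ∈ reach E F T (k + 2))
    (hw' : w ∉ reach E F T (k + 1)) :
    ∃ u, u ∈ reach E F T (k + 1) ∧ u ∉ reach E F T k ∧ E u w := by
  rcases mem_reach_succ.1 hw with h | ⟨⟨u, hu, huw⟩, hF⟩
  · exact absurd h hw'
  · exact ⟨u, hu, fun hk => hw' (step_mem_reach hk huw hF), huw⟩

/-- A vertex first reached after exactly five steps does not send an edge to the start. -/
lemma SparseC6.not_edge_of_mem_reach_five (h : SparseC6 E) {F : Finset V} {t v : V}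
    (h5 : v ∈ reach E F {t} 5) (h4 : v ∉ reach E F {t} 4) : ¬ E v t := by
  intro hvt
  obtain ⟨p4, hp4, hp4', e4⟩ := exists_pred_of_mem_reach h5 h4
  obtain ⟨p3, hp3, hp3', e3⟩ := exists_pred_of_mem_reach hp4 hp4'
  obtain ⟨p2, hp2, hp2', e2⟩ := exists_pred_of_mem_reach hp3 hp3'
  obtain ⟨p1, hp1, hp1', e1⟩ := exists_pred_of_mem_reach hp2 hp2'
  rcases mem_reach_succ.1 hp1 with h' | ⟨⟨t', ht', e0⟩, -⟩
  · exact hp1' h'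
  obtain rfl : t' = t := by simpa [reach] using ht'
  have m01 := @reach_subset_succ V _ E _ F {t'} 0
  have m12 := @reach_subset_succ V _ E _ F {t'} 1
  have m23 := @reach_subset_succ V _ E _ F {t'} 2
  have m34 := @reach_subset_succ V _ E _ F {t'} 3
  refine h.noC6 t' p1 p2 p3 p4 v ?_ ?_ ?_ e0 e1 e2 e3 e4 hvt
  all_goals simp only [subset_iff] at m01 m12 m23 m34
  all_goals grind

/-- If `v` reaches `t` by paths of lengths one to four inside `F`, then `t` does not reach `v`
outside `F` in at most five steps. -/
lemma SparseC6.notMem_reach_five (h : SparseC6 E) {F : Finset V} {v t z z₁ z₂ p q r : V}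
    (hv : v ∉ F) (ht : t ∉ F) (hvt : E v t)
    (hz : z ∈ F) (hvz : E v z) (hzt : E z t)
    (hz₁ : z₁ ∈ F) (hz₂ : z₂ ∈ F) (hvz₁ : E v z₁) (hz₁₂ : E z₁ z₂) (hz₂t : E z₂ t)
    (hp : p ∈ F) (hq : q ∈ F) (hr : r ∈ F) (hvp : E v p) (hpq : E p q) (hqr : E q r)
    (hrt : E r t) : v ∉ reach E F {t} 5 := by
  have ir := h.irrefl
  have as := h.asymm
  have m01 := @reach_subset_succ V _ E _ F {t} 0
  have m12 := @reach_subset_succ V _ E _ F {t} 1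
  have m23 := @reach_subset_succ V _ E _ F {t} 2
  have nF : ∀ {k w}, w ∈ reach E F {t} k → w ∉ F := fun hw =>
    notMem_of_mem_reach (by simpa using ht) hw
  simp only [subset_iff] at m01 m12 m23
  have n0 : v ∉ reach E F {t} 0 := by
    have : v ≠ t := by rintro rfl; exact ir _ hvt
    simpa [reach] using this
  have n1 : v ∉ reach E F {t} 1 := by
    intro hm
    rcases mem_reach_succ.1 hm with h' | ⟨⟨t', ht', e0⟩, -⟩
    · exact n0 h'
    obtain rfl : t' = t := by simpa [reach] using ht'
    exact as _ _ e0 hvt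
  have first : ∀ {p1}, p1 ∈ reach E F {t} 1 → p1 ∉ reach E F {t} 0 → E t p1 := by
    intro p1 hp1 hp1'
    rcases mem_reach_succ.1 hp1 with h' | ⟨⟨t', ht', e0⟩, -⟩
    · exact absurd h' hp1'
    obtain rfl : t' = t := by simpa [reach] using ht'
    exact e0
  have t0 : t ∈ reach E F {t} 0 := by simp [reach]
  have n2 : v ∉ reach E F {t} 2 := by
    intro hm
    obtain ⟨p1, hp1, hp1', e1⟩ := exists_pred_of_mem_reach hm n1
    have e0 := first hp1 hp1'
    have f1 := nF hp1
    refine h.noC6 v p q r t p1 ?_ ?_ ?_ hvp hpq hqr hrt e0 e1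
    all_goals grind
  have n3 : v ∉ reach E F {t} 3 := by
    intro hm
    obtain ⟨p2, hp2, hp2', e2⟩ := exists_pred_of_mem_reach hm n2
    obtain ⟨p1, hp1, hp1', e1⟩ := exists_pred_of_mem_reach hp2 hp2'
    have e0 := first hp1 hp1'
    have f1 := nF hp1
    have f2 := nF hp2
    refine h.noC6 v z₁ z₂ t p1 p2 ?_ ?_ ?_ hvz₁ hz₁₂ hz₂t e0 e1 e2
    all_goals grind
  have n4 : v ∉ reach E F {t} 4 := by
    intro hm
    obtain ⟨p3, hp3, hp3', e3⟩ := exists_pred_of_mem_reach hm n3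
    obtain ⟨p2, hp2, hp2', e2⟩ := exists_pred_of_mem_reach hp3 hp3'
    obtain ⟨p1, hp1, hp1', e1⟩ := exists_pred_of_mem_reach hp2 hp2'
    have e0 := first hp1 hp1'
    have f1 := nF hp1
    have f2 := nF hp2
    have f3 := nF hp3
    refine h.noC6 v z t p1 p2 p3 ?_ ?_ ?_ hvz hzt e0 e1 e2 e3
    all_goals grind
  exact fun hm => h.not_edge_of_mem_reach_five hm n4 hvt

lemma card_union_nbhd_sdiff_ge {F T : Finset V} {g : V} {D δ : ℝ}
    (hD : D ≤ #(nbhd E g \ F)) (hδ : (#(nbhd E g ∩ T) : ℝ) ≤ #T / 3 + δ) :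
    2 / 3 * (#T : ℝ) + D - δ ≤ #(T ∪ (nbhd E g \ F)) := by
  have h1 : (#(T ∪ (nbhd E g \ F)) : ℝ) + #(T ∩ (nbhd E g \ F)) = #T + #(nbhd E g \ F) := by
    exact_mod_cast card_union_add_card_inter _ _
  have h2 : (#(T ∩ (nbhd E g \ F)) : ℝ) ≤ #(nbhd E g ∩ T) := by
    exact_mod_cast card_le_card (by intro x; simp only [mem_inter, mem_sdiff]; tauto)
  linarith

lemma card_reach_succ_ge {F T : Finset V} {k : ℕ} {g : V} (hg : g ∈ reach E F T k) {D δ : ℝ}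
    (hD : D ≤ #(nbhd E g \ F))
    (hδ : (#(nbhd E g ∩ reach E F T k) : ℝ) ≤ #(reach E F T k) / 3 + δ) :
    2 / 3 * (#(reach E F T k) : ℝ) + D - δ ≤ #(reach E F T (k + 1)) := by
  refine (card_union_nbhd_sdiff_ge hD hδ).trans ?_
  have : reach E F T k ∪ (nbhd E g \ F) ⊆ reach E F T (k + 1) :=
    union_subset_union_right (sdiff_subset_sdiff (subset_biUnion_of_mem _ hg) Subset.rfl)
  exact_mod_cast card_le_card this

lemma exists_card_indeg_ge {S : Finset V} (hS : S.Nonempty) {D : ℝ}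
    (hD : ∀ x ∈ S, D ≤ #(nbhd E x ∩ S)) : ∃ v ∈ S, D ≤ #(nbhd (flip E) v ∩ S) := by
  classical
  by_contra! hc
  have h1 := sum_card_bipartiteAbove_eq_sum_card_bipartiteBelow (s := S) (t := S) E
  have h2 : ∀ x, #(bipartiteAbove E S x) = #(nbhd E x ∩ S) := fun x => by
    congr 1; ext y; simp [mem_bipartiteAbove, mem_nbhd, and_comm]
  have h3 : ∀ x, #(bipartiteBelow E S x) = #(nbhd (flip E) x ∩ S) := fun x => by
    congr 1; ext y; simp [mem_bipartiteBelow, mem_nbhd, and_comm, flip]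
  simp only [h2, h3] at h1
  have h4 : ∑ x ∈ S, (#(nbhd (flip E) x ∩ S) : ℝ) < ∑ _x ∈ S, D := sum_lt_sum_of_nonempty hS hc
  have h5 : ∑ _x ∈ S, D ≤ ∑ x ∈ S, (#(nbhd E x ∩ S) : ℝ) := sum_le_sum hD
  have h6 : ∑ x ∈ S, (#(nbhd E x ∩ S) : ℝ) = ∑ x ∈ S, (#(nbhd (flip E) x ∩ S) : ℝ) := by
    exact_mod_cast h1
  linarith

/-- If all vertices of a nonempty set have two out-neighbours in it, it contains a path on four
vertices. -/
lemma exists_path_four_of_card {A : Finset V} (hA : A.Nonempty)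
    (hd : ∀ x ∈ A, 2 ≤ #(nbhd E x ∩ A)) : ∃ x₁ ∈ A, ∃ x₂ ∈ A, ∃ x₃ ∈ A, ∃ t ∈ A,
      E x₁ x₂ ∧ E x₂ x₃ ∧ E x₃ t ∧ t ≠ x₁ := by
  obtain ⟨x₁, h₁⟩ := hA
  obtain ⟨x₂, h₂⟩ := card_pos.1 (by have := hd x₁ h₁; omega : 0 < #(nbhd E x₁ ∩ A))
  rw [mem_inter, mem_nbhd] at h₂
  obtain ⟨x₃, h₃⟩ := card_pos.1 (by have := hd x₂ h₂.2; omega : 0 < #(nbhd E x₂ ∩ A))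
  rw [mem_inter, mem_nbhd] at h₃
  obtain ⟨t, ht, hne⟩ := exists_mem_ne (by have := hd x₃ h₃.2; omega : 1 < #(nbhd E x₃ ∩ A)) x₁
  rw [mem_inter, mem_nbhd] at ht
  exact ⟨x₁, h₁, x₂, h₂.2, x₃, h₃.2, t, ht.2, h₂.1, h₃.1, ht.1, hne⟩

/-- The end of a path inside an out-neighbourhood of `v` is far from `v`. -/
lemma SparseC6.notMem_reach_five_of_path (h : SparseC6 E) {F : Finset V} {v x₁ x₂ x₃ t : V}
    (hv : v ∉ F) (ht : t ∉ F) (h1 : E v x₁) (h2 : E v x₂) (h3 : E v x₃) (h4 : E v t)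
    (e1 : E x₁ x₂) (e2 : E x₂ x₃) (e3 : E x₃ t) (hne : t ≠ x₁) :
    v ∉ F ∪ {x₁, x₂, x₃} ∧ t ∉ F ∪ {x₁, x₂, x₃} ∧ v ∉ reach E (F ∪ {x₁, x₂, x₃}) {t} 5 := by
  have ir := h.irrefl
  have as := h.asymm
  have hv' : v ∉ F ∪ {x₁, x₂, x₃} := by grind
  have ht' : t ∉ F ∪ {x₁, x₂, x₃} := by grind
  exact ⟨hv', ht', h.notMem_reach_five hv' ht' h4 (z := x₃) (z₁ := x₂) (z₂ := x₃) (p := x₁)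
    (q := x₂) (r := x₃) (by simp) h3 e3 (by simp) (by simp) h2 e2 e3 (by simp) (by simp)
    (by simp) h1 e1 e2 e3⟩

/-- Every nonempty set has a vertex with inner outdegree at most about a third of its size. -/
lemma SparseC6.exists_small_inner_outdeg (h : SparseC6 E) (hn : 10 ^ 9 ≤ Fintype.card V)
    (S : Finset V) (hS : S.Nonempty) :
    ∃ x ∈ S, (#(nbhd E x ∩ S) : ℝ) ≤ #S / 3 + Fintype.card V / 1000 := by
  obtain ⟨H, hH, hc⟩ := h.exists_triangle_cover hn
  have hn' : (10 ^ 9 : ℝ) ≤ Fintype.card V := by exact_mod_cast hn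
  have hH' : (#H : ℝ) ≤ 4000 := by exact_mod_cast hH
  set n := Fintype.card V
  induction hk : #S using Nat.strong_induction_on generalizing S with
  | _ k ih =>
  subst hk
  by_contra! hcon
  set D : ℝ := #S / 3 + n / 1000 with hDdef
  set S' := S \ H with hS'
  have hS'S : S' ⊆ S := sdiff_subset
  have hSpos : (0 : ℝ) ≤ #S := by positivity
  have hdeg : ∀ x ∈ S', D - 4000 ≤ #(nbhd E x ∩ S') := by
    intro x hx
    have h1 := hcon x (hS'S hx)
    have h2 : (#(nbhd E x ∩ S) : ℝ) ≤ #(nbhd E x ∩ S') + #H := by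
      exact_mod_cast card_inter_add_card_le _ _ _
    linarith
  have hne : S'.Nonempty := by
    obtain ⟨x, hx⟩ := hS
    have h1 := hcon x hx
    have h2 : (#(nbhd E x ∩ S) : ℝ) ≤ #(nbhd E x ∩ S') + #H := by
      exact_mod_cast card_inter_add_card_le _ _ _
    have h3 : (0 : ℝ) < #(nbhd E x ∩ S') := by linarith
    obtain ⟨y, hy⟩ := card_pos.1 (by exact_mod_cast h3 : 0 < #(nbhd E x ∩ S'))
    exact ⟨y, (mem_inter.1 hy).2⟩
  obtain ⟨v, hv, hvin⟩ := exists_card_indeg_ge hne hdeg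
  have hvout := hdeg v hv
  set A := nbhd E v ∩ S' with hA
  have hAne : A.Nonempty := by
    rw [← card_pos]
    have : (0 : ℝ) < #A := by linarith
    exact_mod_cast this
  by_cases hcase : ∃ x ∈ A, #(nbhd E x ∩ A) ≤ 1
  · obtain ⟨x, hx, hxA⟩ := hcase
    obtain ⟨hvx, hxS'⟩ := mem_inter.1 hx
    rw [mem_nbhd] at hvx
    have hxout := hdeg x hxS'
    have h1 := card_add_card_add_card_le A (nbhd E x ∩ S') (nbhd (_root_.flip E) v ∩ S')
    have h2 : A ∪ nbhd E x ∩ S' ∪ nbhd (_root_.flip E) v ∩ S' ⊆ S := by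
      intro y hy
      simp only [hA, mem_union, mem_inter] at hy
      exact hS'S (by tauto)
    have h3 : A ∩ (nbhd E x ∩ S') ⊆ nbhd E x ∩ A := by
      intro y; simp only [mem_inter]; tauto
    have h4 : #(A ∩ (nbhd (_root_.flip E) v ∩ S')) = 0 := by
      rw [card_eq_zero, eq_empty_iff_forall_notMem]
      intro y hy
      simp only [hA, mem_inter, mem_nbhd] at hy
      exact h.asymm _ _ hy.1.1 hy.2.1
    have h5 : (nbhd E x ∩ S') ∩ (nbhd (_root_.flip E) v ∩ S') ⊆
        nbhd E x ∩ nbhd (_root_.flip E) v := by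
      intro y; simp only [mem_inter]; tauto
    have h6 := hc v (mem_sdiff.1 hv).2 x (mem_sdiff.1 hxS').2 hvx
    have h7 := card_le_card h2
    have h8 := card_le_card h3
    have h9 := card_le_card h5
    have h10 : #A + #(nbhd E x ∩ S') + #(nbhd (_root_.flip E) v ∩ S') ≤
      #S + 1 + #(nbhd E x ∩ nbhd (_root_.flip E) v) := by omega
    have h11 : (#A + #(nbhd E x ∩ S') + #(nbhd (_root_.flip E) v ∩ S') : ℝ) ≤
      #S + 1 + #(nbhd E x ∩ nbhd (_root_.flip E) v) := by exact_mod_cast h10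
    have h12 : (1000 * #(nbhd E x ∩ nbhd (_root_.flip E) v) : ℝ) < n := by exact_mod_cast h6
    linarith
  · push Not at hcase
    obtain ⟨x₁, h₁, x₂, h₂, x₃, h₃, t, ht, e1, e2, e3, hne'⟩ := exists_path_four_of_card hAne hcase
    simp only [hA, mem_inter, mem_nbhd] at h₁ h₂ h₃ ht
    obtain ⟨hvF, htF, hfar⟩ := h.notMem_reach_five_of_path (F := univ \ S') (v := v) (t := t)
      (by simpa using hv) (by simpa using ht.2) h₁.1 h₂.1 h₃.1 ht.1 e1 e2 e3 hne'
    set F := (univ \ S') ∪ {x₁, x₂, x₃} with hF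
    have hRS : ∀ {k w}, w ∈ reach E F {t} k → w ∈ S' := by
      intro k w hw
      have := notMem_of_mem_reach (by simpa using htF) hw
      simp only [hF, mem_union, mem_sdiff, mem_univ, true_and, not_or, not_not] at this
      exact this.1
    have hD' : ∀ {k w}, w ∈ reach E F {t} k → D - 4003 ≤ #(nbhd E w \ F) := by
      intro k w hw
      have h1 := hdeg w (hRS hw)
      have h2 : nbhd E w ∩ S' ⊆ (nbhd E w \ F) ∪ {x₁, x₂, x₃} := by
        intro y
        simp only [hF, mem_union, mem_inter, mem_sdiff, mem_univ, true_and]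
        tauto
      have h3 := (card_le_card h2).trans (card_union_le _ _)
      have h4 := card_le_three (a := x₁) (b := x₂) (c := x₃)
      have h5 : (#(nbhd E w ∩ S') : ℝ) ≤ #(nbhd E w \ F) + 3 := by
        exact_mod_cast h3.trans (by omega)
      linarith
    have hgrow : ∀ k ≤ 4,
        2 / 3 * (#(reach E F {t} k) : ℝ) + (D - 4003) - n / 1000 ≤ #(reach E F {t} (k + 1)) := by
      intro k hk
      have hlt : reach E F {t} k ⊂ S := by
        refine ⟨fun w hw => hS'S (hRS hw), fun hsub => hfar ?_⟩
        exact reach_mono (by omega) (hsub (hS'S hv))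
      have htk : t ∈ reach E F {t} k := reach_mono (Nat.zero_le k) (by simp [reach])
      obtain ⟨g, hg, hgs⟩ := ih _ (card_lt_card hlt) _ ⟨t, htk⟩ rfl
      exact card_reach_succ_ge hg (hD' hg) hgs
    have g1 : D - 4003 ≤ #(reach E F {t} 1) := by
      refine (hD' (k := 0) (w := t) (by simp [reach])).trans ?_
      have : nbhd E t \ F ⊆ reach E F {t} 1 := by
        intro y hy
        simp only [mem_sdiff, mem_nbhd] at hy
        exact step_mem_reach (by simp [reach]) hy.1 hy.2
      exact_mod_cast card_le_card this
    have g2 := hgrow 1 (by norm_num)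
    have g3 := hgrow 2 (by norm_num)
    norm_num only at g2 g3
    have hdisj : Disjoint (reach E F {t} 3) (nbhd (_root_.flip E) v ∩ S') := by
      rw [disjoint_left]
      intro y hy hy'
      simp only [mem_inter, mem_nbhd] at hy'
      exact hfar (reach_mono (by norm_num) (step_mem_reach hy hy'.1 hvF))
    have hsub : reach E F {t} 3 ∪ nbhd (_root_.flip E) v ∩ S' ⊆ S :=
      union_subset (fun w hw => hS'S (hRS hw)) (inter_subset_right.trans hS'S)
    have hcard := card_le_card hsub
    rw [card_union_of_disjoint hdisj] at hcard
    have hcard' : (#(reach E F {t} 3) : ℝ) + #(nbhd (_root_.flip E) v ∩ S') ≤ #S := by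
      exact_mod_cast hcard
    linarith

lemma SparseC6.card_nbhd_sdiff_ge (h : SparseC6 E) (hn : 10 ^ 9 ≤ Fintype.card V) {F : Finset V}
    (hF : #F ≤ 20) (u : V) :
    (Fintype.card V : ℝ) / 4 - Fintype.card V / 1000 ≤ #(nbhd E u \ F) := by
  have hn' : (10 ^ 9 : ℝ) ≤ Fintype.card V := by exact_mod_cast hn
  have hF' : (#F : ℝ) ≤ 20 := by exact_mod_cast hF
  have h1 := card_le_card_sdiff_add' (nbhd E u) F
  have h2 := h.outdeg u
  linarith

lemma SparseC6.card_reach_succ_ge (h : SparseC6 E) (hn : 10 ^ 9 ≤ Fintype.card V) {F T : Finset V}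
    (hF : #F ≤ 20) (hT : T.Nonempty) (k : ℕ) :
    2 / 3 * (#(reach E F T k) : ℝ) + Fintype.card V / 4 - 2 * (Fintype.card V / 1000) ≤
      #(reach E F T (k + 1)) := by
  obtain ⟨g, hg, hgs⟩ := h.exists_small_inner_outdeg hn (reach E F T k)
    (hT.mono (reach_mono (Nat.zero_le k)))
  have := _root_.card_reach_succ_ge hg (h.card_nbhd_sdiff_ge hn hF g) hgs
  linarith

lemma SparseC6.card_reach_one_ge (h : SparseC6 E) (hn : 10 ^ 9 ≤ Fintype.card V) {F : Finset V}
    (hF : #F ≤ 20) (v : V) :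
    (Fintype.card V : ℝ) / 4 - Fintype.card V / 1000 ≤ #(reach E F {v} 1) := by
  refine (h.card_nbhd_sdiff_ge hn hF v).trans ?_
  have : nbhd E v \ F ⊆ reach E F {v} 1 := by
    intro y hy
    simp only [mem_sdiff, mem_nbhd] at hy
    exact step_mem_reach (by simp [reach]) hy.1 hy.2
  exact_mod_cast card_le_card this

lemma SparseC6.card_reach_three_ge_weak (h : SparseC6 E) (hn : 10 ^ 9 ≤ Fintype.card V)
    {F : Finset V} (hF : #F ≤ 20) (v : V) :
    19 / 36 * (Fintype.card V : ℝ) - 4 * (Fintype.card V / 1000) ≤ #(reach E F {v} 3) := by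
  have h1 := h.card_reach_one_ge hn hF v
  have h2 := h.card_reach_succ_ge hn hF (singleton_nonempty v) 1
  have h3 := h.card_reach_succ_ge hn hF (singleton_nonempty v) 2
  norm_num only at h2 h3
  linarith

lemma card_union_le_card_reach_two {F : Finset V} {v y : V} (hy : E v y) (hyF : y ∉ F) :
    (#(nbhd E v ∪ nbhd E y) : ℝ) ≤ #(reach E F {v} 2) + #F := by
  have hv : v ∈ reach E F {v} 0 := by simp [reach]
  have : (nbhd E v ∪ nbhd E y) \ F ⊆ reach E F {v} 2 := by
    intro w hw
    simp only [mem_sdiff, mem_union, mem_nbhd] at hw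
    rcases hw.1 with h1 | h1
    · exact reach_subset_succ (step_mem_reach hv h1 hw.2)
    · exact step_mem_reach (step_mem_reach hv hy hyF) h1 hw.2
  have h1 := card_le_card_sdiff_add' (nbhd E v ∪ nbhd E y) F
  have h2 : (#((nbhd E v ∪ nbhd E y) \ F) : ℝ) ≤ #(reach E F {v} 2) := by
    exact_mod_cast card_le_card this
  linarith

open scoped Classical in
/-- The out-neighbours of `v` from which `v` cannot be reached in five steps outside `F`. -/
noncomputable def farNbhd (E : V → V → Prop) (F : Finset V) (v : V) : Finset V :=
  (nbhd E v \ F).filter fun t => v ∉ reach E F {t} 5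

lemma mem_farNbhd {F : Finset V} {v t : V} :
    t ∈ farNbhd E F v ↔ (E v t ∧ t ∉ F) ∧ v ∉ reach E F {t} 5 := by
  simp [farNbhd, mem_nbhd]

lemma SparseC6.mem_farNbhd_of_edge (h : SparseC6 E) {F : Finset V} {v t t' : V}
    (ht : t ∈ farNbhd E F v) (htt : E t t') (hvt : E v t') (hF : t' ∉ F) :
    t' ∈ farNbhd E F v := by
  rw [mem_farNbhd] at ht ⊢
  refine ⟨⟨hvt, hF⟩, fun h5 => ?_⟩
  by_cases h4 : v ∈ reach E F {t'} 4
  · exact ht.2 (reach_succ_of_step htt hF h4)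
  · exact h.not_edge_of_mem_reach_five h5 h4 hvt

/-- `reach E F (farNbhd E F v) 2` is disjoint from the vertices reaching `v` in three steps. -/
lemma card_reach_add_card_reach_flip_le {F T : Finset V} {v : V} (hv : v ∉ F)
    (hT : ∀ t ∈ T, v ∉ reach E F {t} 5) :
    (#(reach E F T 2) : ℝ) + #(reach (flip E) F {v} 3) ≤ Fintype.card V := by
  have hdisj : Disjoint (reach E F T 2) (reach (flip E) F {v} 3) := by
    rw [disjoint_left]
    intro s hs hs'
    obtain ⟨t, ht, hst⟩ := exists_mem_reach_singleton hs
    exact hT t ht (reach_add hv hst hs')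
  have := card_le_univ (reach E F T 2 ∪ reach (flip E) F {v} 3)
  rw [card_union_of_disjoint hdisj] at this
  exact_mod_cast this

lemma SparseC6.card_farNbhd_le (h : SparseC6 E) (hn : 10 ^ 9 ≤ Fintype.card V) {F : Finset V}
    (hF : #F ≤ 20) {v : V} (hv : v ∉ F) (hK : (farNbhd E F v).Nonempty) :
    4 / 9 * (#(farNbhd E F v) : ℝ) + 5 / 12 * Fintype.card V - 4 * (Fintype.card V / 1000) +
      #(reach (_root_.flip E) F {v} 3) ≤ Fintype.card V := by
  have h1 := h.card_reach_succ_ge hn hF hK 0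
  have h2 := h.card_reach_succ_ge hn hF hK 1
  norm_num only at h1 h2
  have h0 : reach E F (farNbhd E F v) 0 = farNbhd E F v := rfl
  rw [h0] at h1
  have h3 := card_reach_add_card_reach_flip_le (T := farNbhd E F v) hv
    fun t ht => (mem_farNbhd.1 ht).2
  have h4 : (0 : ℝ) ≤ Fintype.card V := by positivity
  linarith

lemma SparseC6.exists_card_union_ge (h : SparseC6 E) (hn : 10 ^ 9 ≤ Fintype.card V) {F : Finset V}
    (hF : #F ≤ 20) {v : V} (hK : (farNbhd E F v).Nonempty) :
    ∃ y ∈ farNbhd E F v, (Fintype.card V : ℝ) / 2 - #(farNbhd E F v) / 3 -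
      2 * (Fintype.card V / 1000) ≤ #(nbhd E v ∪ nbhd E y) := by
  have hn' : (10 ^ 9 : ℝ) ≤ Fintype.card V := by exact_mod_cast hn
  have hF' : (#F : ℝ) ≤ 20 := by exact_mod_cast hF
  obtain ⟨y, hy, hys⟩ := h.exists_small_inner_outdeg hn _ hK
  refine ⟨y, hy, ?_⟩
  have hsub : nbhd E v ∩ nbhd E y ⊆ (nbhd E y ∩ farNbhd E F v) ∪ F := by
    intro w hw
    simp only [mem_inter, mem_nbhd, mem_union] at hw ⊢
    by_cases hwF : w ∈ F
    · exact Or.inr hwF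
    · exact Or.inl ⟨hw.2, h.mem_farNbhd_of_edge hy hw.2 hw.1 hwF⟩
  have h1 : (#(nbhd E v ∩ nbhd E y) : ℝ) ≤ #(nbhd E y ∩ farNbhd E F v) + #F := by
    exact_mod_cast (card_le_card hsub).trans (card_union_le _ _)
  have h2 : (#(nbhd E v ∪ nbhd E y) : ℝ) + #(nbhd E v ∩ nbhd E y) = #(nbhd E v) + #(nbhd E y) := by
    exact_mod_cast card_union_add_card_inter _ _
  have h3 := h.outdeg v
  have h4 := h.outdeg y
  linarith

lemma SparseC6.exists_farNbhd_nonempty (h : SparseC6 E) {F : Finset V} {v : V} (hv : v ∉ F)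
    (hA : (nbhd E v \ F).Nonempty) (hd : ∀ x ∈ nbhd E v \ F, 2 ≤ #(nbhd E x ∩ (nbhd E v \ F))) :
    ∃ F', F ⊆ F' ∧ #F' ≤ #F + 3 ∧ v ∉ F' ∧ (farNbhd E F' v).Nonempty := by
  obtain ⟨x₁, h₁, x₂, h₂, x₃, h₃, t, ht, e1, e2, e3, hne⟩ := exists_path_four_of_card hA hd
  simp only [mem_sdiff, mem_nbhd] at h₁ h₂ h₃ ht
  obtain ⟨hvF, htF, hfar⟩ := h.notMem_reach_five_of_path hv ht.2 h₁.1 h₂.1 h₃.1 ht.1 e1 e2 e3 hne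
  exact ⟨_, subset_union_left, (card_union_le _ _).trans (by grw [card_le_three]), hvF,
    t, mem_farNbhd.2 ⟨⟨ht.1, htF⟩, hfar⟩⟩

lemma SparseC6.card_reach_three_ge (h : SparseC6 E) (hn : 10 ^ 9 ≤ Fintype.card V)
    {F : Finset V} (hF : #F ≤ 16) {v : V} (hv : v ∉ F) :
    5 / 9 * (Fintype.card V : ℝ) - 8 * (Fintype.card V / 1000) ≤ #(reach E F {v} 3) := by
  have hn' : (10 ^ 9 : ℝ) ≤ Fintype.card V := by exact_mod_cast hn
  have hF' : (#F : ℝ) ≤ 16 := by exact_mod_cast hF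
  have key : ∃ y, E v y ∧ y ∉ F ∧
      11 / 24 * (Fintype.card V : ℝ) - 8 * (Fintype.card V / 1000) ≤
        #(nbhd E v ∪ nbhd E y) := by
    by_cases hc : ∀ x ∈ nbhd E v \ F, 2 ≤ #(nbhd E x ∩ (nbhd E v \ F))
    · have hA : (nbhd E v \ F).Nonempty := by
        rw [← card_pos]
        have := h.card_nbhd_sdiff_ge hn (by omega : #F ≤ 20) v
        exact_mod_cast (by linarith : (0 : ℝ) < #(nbhd E v \ F))
      obtain ⟨F', hFF, hFc, hvF', hK⟩ := h.exists_farNbhd_nonempty hv hA hc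
      obtain ⟨y, hy, hys⟩ := h.exists_card_union_ge hn (by omega) hK
      have h1 := h.card_farNbhd_le hn (by omega) hvF' hK
      have h2 := h.flip.card_reach_three_ge_weak hn (by omega : #F' ≤ 20) v
      rw [mem_farNbhd] at hy
      exact ⟨y, hy.1.1, fun hyF => hy.1.2 (hFF hyF), by linarith⟩
    · push Not at hc
      obtain ⟨y, hy, hyc⟩ := hc
      simp only [mem_sdiff, mem_nbhd] at hy
      refine ⟨y, hy.1, hy.2, ?_⟩
      have hsub : nbhd E v ∩ nbhd E y ⊆ (nbhd E y ∩ (nbhd E v \ F)) ∪ F := by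
        intro w; simp only [mem_inter, mem_union, mem_sdiff]; tauto
      have h1 : (#(nbhd E v ∩ nbhd E y) : ℝ) ≤ 1 + #F := by
        exact_mod_cast (card_le_card hsub).trans ((card_union_le _ _).trans (by omega))
      have h2 : (#(nbhd E v ∪ nbhd E y) : ℝ) + #(nbhd E v ∩ nbhd E y) =
          #(nbhd E v) + #(nbhd E y) := by
        exact_mod_cast card_union_add_card_inter _ _
      have h3 := h.outdeg v
      have h4 := h.outdeg y
      linarith
  obtain ⟨y, hvy, hyF, hy⟩ := key
  have h1 := card_union_le_card_reach_two hvy hyF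
  have h2 := h.card_reach_succ_ge hn (by omega : #F ≤ 20) (singleton_nonempty v) 2
  norm_num only at h2
  linarith

/-- After deleting few vertices, any two remaining vertices are joined by a walk of length at most
five. -/
lemma SparseC6.mem_reach_five (h : SparseC6 E) (hn : 10 ^ 9 ≤ Fintype.card V)
    {F : Finset V} (hF : #F ≤ 10) {v t : V} (hv : v ∉ F) (ht : t ∉ F) :
    v ∈ reach E F {t} 5 := by
  by_contra hfar
  have hn' : (10 ^ 9 : ℝ) ≤ Fintype.card V := by exact_mod_cast hn
  have hF' : (#F : ℝ) ≤ 10 := by exact_mod_cast hF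
  have h1 := card_reach_add_card_reach_flip_le (T := {t}) hv (by simpa using hfar)
  have h2 := h.flip.card_reach_three_ge hn (by omega) hv
  have hp : ∀ p, E t p → p ∉ F → (#(nbhd E t ∪ nbhd E p) : ℝ) ≤
      4 / 9 * Fintype.card V + 9 * (Fintype.card V / 1000) := by
    intro p htp hpF
    have := card_union_le_card_reach_two htp hpF
    linarith
  have hA : (nbhd E t \ F).Nonempty := by
    rw [← card_pos]
    have := h.card_nbhd_sdiff_ge hn (by omega : #F ≤ 20) t
    exact_mod_cast (by linarith : (0 : ℝ) < #(nbhd E t \ F))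
  obtain ⟨F', hFF, hFc, htF', hK⟩ := h.exists_farNbhd_nonempty ht hA <| by
    intro p hpm
    simp only [mem_sdiff, mem_nbhd] at hpm
    have h3 := hp p hpm.1 hpm.2
    have hsub : nbhd E t ∩ nbhd E p ⊆ (nbhd E p ∩ (nbhd E t \ F)) ∪ F := by
      intro w; simp only [mem_inter, mem_union, mem_sdiff]; tauto
    have h4 : (#(nbhd E t ∩ nbhd E p) : ℝ) ≤ #(nbhd E p ∩ (nbhd E t \ F)) + #F := by
      exact_mod_cast (card_le_card hsub).trans (card_union_le _ _)
    have h5 : (#(nbhd E t ∪ nbhd E p) : ℝ) + #(nbhd E t ∩ nbhd E p) =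
        #(nbhd E t) + #(nbhd E p) := by
      exact_mod_cast card_union_add_card_inter _ _
    have h6 := h.outdeg t
    have h7 := h.outdeg p
    exact_mod_cast (by linarith : (2 : ℝ) ≤ #(nbhd E p ∩ (nbhd E t \ F)))
  obtain ⟨y, hy, hys⟩ := h.exists_card_union_ge hn (by omega) hK
  have h3 := h.card_farNbhd_le hn (by omega) htF' hK
  have h4 := h.flip.card_reach_three_ge hn (by omega : #F' ≤ 16) htF'
  rw [mem_farNbhd] at hy
  have h5 := hp y hy.1.1 fun hyF => hy.1.2 (hFF hyF)
  linarith

lemma SparseC6.not_path_in_nbhd (h : SparseC6 E) (hn : 10 ^ 9 ≤ Fintype.card V)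
    {F : Finset V} (hF : #F ≤ 7) {v x₁ x₂ x₃ t : V} (hv : v ∉ F) (ht : t ∉ F)
    (h1 : E v x₁) (h2 : E v x₂) (h3 : E v x₃) (h4 : E v t)
    (e1 : E x₁ x₂) (e2 : E x₂ x₃) (e3 : E x₃ t) : t = x₁ := by
  by_contra hne
  obtain ⟨hvF, htF, hfar⟩ := h.notMem_reach_five_of_path hv ht h1 h2 h3 h4 e1 e2 e3 hne
  refine hfar (h.mem_reach_five hn ((card_union_le _ _).trans ?_) hvF htF)
  have := card_le_three (a := x₁) (b := x₂) (c := x₃)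
  omega

lemma SparseC6.not_path_four_to (h : SparseC6 E) (hn : 10 ^ 9 ≤ Fintype.card V)
    {v y y₂ y₃ p q r : V} (hy : E v y) (hy₂ : E v y₂) (hy₃ : E v y₃) (e1 : E y₂ y₃) (e2 : E y₃ y)
    (hp : E v p) (hpq : E p q) (hqr : E q r) (hry : E r y) (hrv : r ≠ v) : p = y := by
  by_contra hpy
  have ir := h.irrefl
  have as := h.asymm
  have hvF : v ∉ ({y₂, y₃, p, q, r} : Finset V) := by
    simp only [mem_insert, mem_singleton, not_or]
    refine ⟨?_, ?_, ?_, ?_, hrv.symm⟩ <;> rintro rfl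
    · exact ir _ hy₂
    · exact ir _ hy₃
    · exact ir _ hp
    · exact as _ _ hp hpq
  have hyF : y ∉ ({y₂, y₃, p, q, r} : Finset V) := by
    simp only [mem_insert, mem_singleton, not_or]
    refine ⟨?_, ?_, Ne.symm hpy, ?_, ?_⟩ <;> rintro rfl
    · exact as _ _ e1 e2
    · exact ir _ e2
    · exact as _ _ hqr hry
    · exact ir _ hry
  refine h.notMem_reach_five hvF hyF hy (z := y₃) (z₁ := y₂) (z₂ := y₃) (p := p) (q := q) (r := r)
    (by simp) hy₃ e2 (by simp) (by simp) hy₂ e1 e2 (by simp) (by simp) (by simp) hp hpq hqr hry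
    (h.mem_reach_five hn (card_le_five.trans (by norm_num)) hvF hyF)

lemma SparseC6.exists_small_codeg (h : SparseC6 E) (hn : 10 ^ 9 ≤ Fintype.card V)
    {F : Finset V} (hF : #F ≤ 7) {u : V} (hu : u ∉ F) :
    ∃ p, E u p ∧ p ∉ F ∧ #(nbhd E u ∩ nbhd E p) ≤ #F + 1 := by
  by_contra! hc
  have hn' : (10 ^ 9 : ℝ) ≤ Fintype.card V := by exact_mod_cast hn
  have hA : (nbhd E u \ F).Nonempty := by
    rw [← card_pos]
    have := h.card_nbhd_sdiff_ge hn (by omega : #F ≤ 20) u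
    exact_mod_cast (by linarith : (0 : ℝ) < #(nbhd E u \ F))
  obtain ⟨F', -, hFc, huF', t, ht⟩ := h.exists_farNbhd_nonempty hu hA <| by
    intro x hx
    simp only [mem_sdiff, mem_nbhd] at hx
    have h1 := hc x hx.1 hx.2
    have hsub : nbhd E u ∩ nbhd E x ⊆ (nbhd E x ∩ (nbhd E u \ F)) ∪ F := by
      intro w; simp only [mem_inter, mem_union, mem_sdiff]; tauto
    have := (card_le_card hsub).trans (card_union_le _ _)
    omega
  rw [mem_farNbhd] at ht
  exact ht.2 (h.mem_reach_five hn (by omega) huF' ht.1.2)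

lemma card_add_five_le (A B C D S : Finset V) :
    #A + #B + #C + #D + #S ≤ Fintype.card V + #(A ∩ B) + #(A ∩ C) + #(A ∩ D) + #(A ∩ S) +
      #(B ∩ C) + #(B ∩ D) + #(B ∩ S) + #(C ∩ D) + #(C ∩ S) + #(D ∩ S) := by
  have h1 := card_add_card_add_card_le A B C
  have h2 := card_add_card_add_card_le (A ∪ B ∪ C) D S
  have h3 := card_union_le (A ∩ D ∪ B ∩ D) (C ∩ D)
  have h4 := card_union_le (A ∩ D) (B ∩ D)
  have h5 := card_union_le (A ∩ S ∪ B ∩ S) (C ∩ S)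
  have h6 := card_union_le (A ∩ S) (B ∩ S)
  rw [← union_inter_distrib_right, ← union_inter_distrib_right] at h3 h5
  rw [← union_inter_distrib_right] at h4 h6
  have h7 := card_le_univ (A ∪ B ∪ C ∪ D ∪ S)
  omega

/-- Each out-neighbourhood contains a vertex all of whose inner out-neighbours lie in a prescribed
set of at most two vertices avoiding that vertex. -/
lemma SparseC6.exists_sink (h : SparseC6 E) (hn : 10 ^ 9 ≤ Fintype.card V)
    {X : Finset V} (hX : #X ≤ 2) {v : V} (hv : v ∉ X) :
    ∃ x, E v x ∧ x ∉ X ∧ ∀ w, E v w → E x w → w ∈ X := by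
  by_contra! hc
  have ir := h.irrefl
  have as := h.asymm
  have hn' : (10 ^ 9 : ℝ) ≤ Fintype.card V := by exact_mod_cast hn
  obtain ⟨x₁, hx₁⟩ : (nbhd E v \ X).Nonempty := by
    rw [← card_pos]
    have := h.card_nbhd_sdiff_ge hn (by omega : #X ≤ 20) v
    exact_mod_cast (by linarith : (0 : ℝ) < #(nbhd E v \ X))
  simp only [mem_sdiff, mem_nbhd] at hx₁
  have tri : ∀ y, E v y → y ∉ X → ∃ y₂ y₃, (E v y₂ ∧ y₂ ∉ X) ∧ (E v y₃ ∧ y₃ ∉ X) ∧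
      E y y₂ ∧ E y₂ y₃ ∧ E y₃ y := by
    intro y hvy hy
    obtain ⟨y₂, h2, e1, n2⟩ := hc y hvy hy
    obtain ⟨y₃, h3, e2, n3⟩ := hc y₂ h2 n2
    obtain ⟨y₄, h4, e3, n4⟩ := hc y₃ h3 n3
    obtain rfl := h.not_path_in_nbhd hn (by omega) hv n4 hvy h2 h3 h4 e1 e2 e3
    exact ⟨y₂, y₃, ⟨h2, n2⟩, ⟨h3, n3⟩, e1, e2, e3⟩
  obtain ⟨x₂, x₃, hx₂, hx₃, e1, e2, e3⟩ := tri x₁ hx₁.1 hx₁.2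
  have n12 : x₁ ≠ x₂ := by rintro rfl; exact ir _ e1
  have n23 : x₂ ≠ x₃ := by rintro rfl; exact ir _ e2
  have n31 : x₃ ≠ x₁ := by rintro rfl; exact ir _ e3
  have hvne : ∀ {y}, E v y → y ≠ v := by rintro y hy rfl; exact ir _ hy
  obtain ⟨p, hp, hpn, hpc⟩ := h.exists_small_codeg hn (F := {v, x₁, x₂}) (u := x₃)
    (card_le_three.trans (by norm_num)) (by simp [hvne hx₃.1, n31, n23.symm])
  obtain ⟨q, hq, hqn, hqc⟩ := h.flip.exists_small_codeg hn (F := {v, x₂, x₃}) (u := x₁)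
    (card_le_three.trans (by norm_num)) (by simp [hvne hx₁.1, n31.symm, n12])
  change E q x₁ at hq
  simp only [mem_insert, mem_singleton, not_or] at hpn hqn
  have c1 : #(nbhd E v ∩ nbhd E x₃) ≤ 3 := by
    refine (card_le_card (t := insert x₁ X) fun y hy => ?_).trans
      ((card_insert_le _ _).trans (by omega))
    simp only [mem_inter, mem_nbhd, mem_insert] at hy ⊢
    by_contra! hyn
    exact hyn.1 (h.not_path_in_nbhd hn (by omega) hv hyn.2 hx₁.1 hx₂.1 hx₃.1 hy.1 e1 e2 hy.2)
  have c2 : #(nbhd E v ∩ nbhd E p) ≤ 3 := by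
    refine (card_le_card (t := insert x₂ X) fun y hy => ?_).trans
      ((card_insert_le _ _).trans (by omega))
    simp only [mem_inter, mem_nbhd, mem_insert] at hy ⊢
    by_contra! hyn
    obtain ⟨y₂, y₃, hy₂, hy₃, -, f2, f3⟩ := tri y hy.1 hyn.2
    exact hyn.1 (h.not_path_four_to hn hy.1 hy₂.1 hy₃.1 f2 f3 hx₂.1 e2 hp hy.2 hpn.1).symm
  have c3 : #(nbhd E v ∩ nbhd (_root_.flip E) x₁) ≤ 3 := by
    refine (card_le_card (t := insert x₃ X) fun y hy => ?_).trans
      ((card_insert_le _ _).trans (by omega))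
    simp only [mem_inter, mem_nbhd, _root_.flip, mem_insert] at hy ⊢
    by_contra! hyn
    exact hyn.1 (h.not_path_in_nbhd hn (by omega) hv hx₃.2 hy.1 hx₁.1 hx₂.1 hx₃.1 hy.2 e1 e2).symm
  have c4 : #(nbhd E v ∩ nbhd (_root_.flip E) q) ≤ 3 := by
    refine (card_le_card (t := insert x₂ X) fun y hy => ?_).trans
      ((card_insert_le _ _).trans (by omega))
    simp only [mem_inter, mem_nbhd, _root_.flip, mem_insert] at hy ⊢
    by_contra! hyn
    obtain ⟨y₂, y₃, hy₂, hy₃, -, f2, f3⟩ := tri y hy.1 hyn.2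
    obtain rfl := h.not_path_four_to hn hx₁.1 hx₂.1 hx₃.1 e2 e3 hy₃.1 f3 hy.2 hq hqn.1
    exact hyn.1 (h.not_path_in_nbhd hn (by omega) hv hyn.2 hx₂.1 hx₃.1 hx₁.1 hy.1 e2 e3 f3)
  have c5 : #(nbhd E x₃ ∩ nbhd E p) ≤ 4 := by
    have := card_le_three (a := v) (b := x₁) (c := x₂)
    omega
  have c6 : #(nbhd (_root_.flip E) x₁ ∩ nbhd (_root_.flip E) q) ≤ 4 := by
    have := card_le_three (a := v) (b := x₂) (c := x₃)
    omega
  have c7 : #(nbhd E x₃ ∩ nbhd (_root_.flip E) x₁) ≤ 1 := by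
    refine card_le_one_of_forall_eq v fun s hs => ?_
    simp only [mem_inter, mem_nbhd, _root_.flip] at hs
    by_contra hsv
    exact n12 (h.not_path_four_to hn hx₁.1 hx₂.1 hx₃.1 e2 e3 hx₂.1 e2 hs.1 hs.2 hsv).symm
  have c8 : #(nbhd E p ∩ nbhd (_root_.flip E) x₁) ≤ 1 := by
    refine card_le_one_of_forall_eq v fun s hs => ?_
    simp only [mem_inter, mem_nbhd, _root_.flip] at hs
    by_contra hsv
    exact n31 (h.not_path_four_to hn hx₁.1 hx₂.1 hx₃.1 e2 e3 hx₃.1 hp hs.1 hs.2 hsv)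
  have c9 : #(nbhd E x₃ ∩ nbhd (_root_.flip E) q) ≤ 1 := by
    refine card_le_one_of_forall_eq v fun s hs => ?_
    simp only [mem_inter, mem_nbhd, _root_.flip] at hs
    exact absurd (h.not_path_four_to hn hx₁.1 hx₂.1 hx₃.1 e2 e3 hx₃.1 hs.1 hs.2 hq hqn.1) n31
  have c10 : #(nbhd E p ∩ nbhd (_root_.flip E) q) ≤ 1 := by
    refine card_le_one_of_forall_eq x₂ fun s hs => ?_
    simp only [mem_inter, mem_nbhd, _root_.flip] at hs
    by_contra hs₂
    exact h.noC6 x₃ p s q x₁ x₂ (Ne.symm hqn.2.2) hpn.2.1 hs₂ hp hs.1 hs.2 hq e1 e2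
  have hsum := card_add_five_le (nbhd E v) (nbhd E x₃) (nbhd E p) (nbhd (_root_.flip E) x₁)
    (nbhd (_root_.flip E) q)
  have hsum' : (#(nbhd E v) + #(nbhd E x₃) + #(nbhd E p) + #(nbhd (_root_.flip E) x₁) +
      #(nbhd (_root_.flip E) q) : ℝ) ≤ Fintype.card V + 24 := by
    exact_mod_cast hsum.trans (by omega)
  linarith [h.outdeg v, h.outdeg x₃, h.outdeg p, h.indeg x₁, h.indeg q]

lemma SparseC6.exists_source (h : SparseC6 E) (hn : 10 ^ 9 ≤ Fintype.card V)
    {X : Finset V} (hX : #X ≤ 2) {v : V} (hv : v ∉ X) :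
    ∃ x, E x v ∧ x ∉ X ∧ ∀ w, E w v → E w x → w ∈ X :=
  h.flip.exists_sink hn hX hv

/-- Two out- and two in-neighbourhoods cannot be pairwise disjoint up to one common vertex. -/
lemma SparseC6.not_nearly_disjoint (h : SparseC6 E) {d a x y c : V}
    (h1 : ∀ s, E d s → ¬ E s a) (h2 : ∀ s, E d s → ¬ E x s) (h3 : ∀ s, E d s → ¬ E s y)
    (h4 : ∀ s, E x s → ¬ E s a) (h5 : ∀ s, E s a → ¬ E s y) (h6 : ∀ s, E x s → E s y → s = c) :
    False := by
  have d1 : Disjoint (nbhd E d) (nbhd (_root_.flip E) a) :=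
    disjoint_left.2 fun s hs hs' => h1 s (mem_nbhd.1 hs) (mem_nbhd_flip.1 hs')
  have d2 : Disjoint (nbhd E d ∪ nbhd (_root_.flip E) a) (nbhd E x ∪ nbhd (_root_.flip E) y) := by
    refine disjoint_left.2 fun s hs hs' => ?_
    simp only [mem_union, mem_nbhd, _root_.flip] at hs hs'
    grind
  have d3 : #(nbhd E x ∩ nbhd (_root_.flip E) y) ≤ 1 := by
    refine card_le_one_of_forall_eq c fun s hs => ?_
    simp only [mem_inter, mem_nbhd, _root_.flip] at hs
    exact h6 s hs.1 hs.2
  have e1 := card_union_of_disjoint d1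
  have e2 := card_union_of_disjoint d2
  have e3 := card_union_add_card_inter (nbhd E x) (nbhd (_root_.flip E) y)
  have e4 := card_le_univ
    ((nbhd E d ∪ nbhd (_root_.flip E) a) ∪ (nbhd E x ∪ nbhd (_root_.flip E) y))
  have e5 : (#(nbhd E d) + #(nbhd (_root_.flip E) a) + #(nbhd E x) +
      #(nbhd (_root_.flip E) y) : ℝ) ≤ Fintype.card V + 1 := by
    exact_mod_cast (by omega : #(nbhd E d) + #(nbhd (_root_.flip E) a) + #(nbhd E x) +
      #(nbhd (_root_.flip E) y) ≤ Fintype.card V + 1)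
  linarith [h.outdeg d, h.indeg a, h.outdeg x, h.indeg y]

lemma SparseC6.edge_of_chorded (h : SparseC6 E) (hn : 10 ^ 9 ≤ Fintype.card V) {a b c d : V}
    (hab : E a b) (hbc : E b c) (hcd : E c d) (hda : E d a) (hac : E a c) (hbd : b ≠ d)
    (hM : ∀ s, E d s → ¬ E s a) : E d b := by
  by_contra hdb
  have ir := h.irrefl
  have as := h.asymm
  have nda : d ≠ a := by rintro rfl; exact ir _ hda
  obtain ⟨x, hdx, hxn, hx⟩ := h.exists_sink hn (X := {a, b}) (v := d) card_le_two
    (by simp [nda, hbd.symm])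
  obtain ⟨y, hya, hyn, hy⟩ := h.exists_source hn (X := {d}) (v := a) (by simp)
    (by simpa using nda.symm)
  simp only [mem_insert, mem_singleton, not_or] at hxn hx hyn hy
  refine h.not_nearly_disjoint (d := d) (a := a) (x := x) (y := y) (c := c) hM ?_ ?_ ?_ ?_ ?_
  · intro s h1 h2
    rcases hx s h1 h2 with rfl | rfl
    · exact hM x hdx h2
    · exact hdb h1
  · intro s h1 h2
    refine h.noC6 d s y a b c nda ?_ ?_ h1 h2 hya hab hbc hcd
    · rintro rfl; exact hdb h1
    · rintro rfl; exact as _ _ hya hac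
  · intro t h1 h2
    refine h.noC6 d x t a b c nda hxn.2 ?_ hdx h1 h2 hab hbc hcd
    rintro rfl; exact as _ _ h2 hac
  · intro s h1 h2
    obtain rfl := hy s h1 h2
    exact hM y h2 hya
  · intro t h1 h2
    by_contra ht
    exact h.noC6 d x t y a c (Ne.symm hyn) hxn.1 ht hdx h1 h2 hya hac hcd

lemma SparseC6.false_of_chorded (h : SparseC6 E) (hn : 10 ^ 9 ≤ Fintype.card V) {a b c d w : V}
    (hab : E a b) (hbc : E b c) (hcd : E c d) (hda : E d a) (hac : E a c)
    (hM : ∀ s, E d s → ¬ E s a) (hdb : E d b) (hcw : E c w) (hwd : E w d) : False := by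
  have ir := h.irrefl
  have as := h.asymm
  have nda : d ≠ a := by rintro rfl; exact ir _ hda
  have ndb : d ≠ b := by rintro rfl; exact ir _ hdb
  have ndw : d ≠ w := by rintro rfl; exact ir _ hwd
  have naw : a ≠ w := by rintro rfl; exact as _ _ hac hcw
  by_cases hw : E b w ∧ E w a
  · obtain ⟨hbw, hwa⟩ := hw
    obtain ⟨x, hdx, hxn, hx⟩ := h.exists_sink hn (X := {a, b}) (v := d) card_le_two
      (by simp [nda, ndb])
    obtain ⟨y, hya, hyn, hy⟩ := h.exists_source hn (X := {d, w}) (v := a) card_le_two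
      (by simp [nda.symm, naw])
    simp only [mem_insert, mem_singleton, not_or] at hxn hx hyn hy
    have nxw : x ≠ w := by rintro rfl; exact as _ _ hdx hwd
    refine h.not_nearly_disjoint (d := d) (a := a) (x := x) (y := y) (c := c) hM ?_ ?_ ?_ ?_ ?_
    · intro s h1 h2
      rcases hx s h1 h2 with rfl | rfl
      · exact hM x hdx h2
      · exact h.noC6 d x s w a c ndw hxn.1 (by rintro rfl; exact ir _ hbc) hdx h2 hbw hwa hac hcd
    · intro s h1 h2
      refine h.noC6 d s y a c w nda ?_ hyn.2 h1 h2 hya hac hcw hwd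
      rintro rfl; exact as _ _ h1 hcd
    · intro t h1 h2
      have nxc : x ≠ c := by rintro rfl; exact as _ _ hdx hcd
      by_cases htw : t = w
      · subst htw
        exact h.noC6 d x t a b c nda hxn.2 (by rintro rfl; exact ir _ hcw) hdx h1 h2 hab hbc hcd
      · exact h.noC6 d x t a c w nda nxc htw hdx h1 h2 hac hcw hwd
    · intro s h1 h2
      rcases hy s h1 h2 with rfl | rfl
      · exact hM y h2 hya
      · refine h.noC6 s y a c d b ?_ ?_ ?_ h2 hya hac hcd hdb hbw
        · rintro rfl; exact ir _ hcw
        · exact hyn.1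
        · rintro rfl; exact ir _ hab
    · intro t h1 h2
      by_contra ht
      exact h.noC6 d x t y a c (Ne.symm hyn.1) hxn.1 ht hdx h1 h2 hya hac hcd
  · obtain ⟨x, hdx, hxn, hx⟩ := h.exists_sink hn (X := {a}) (v := d) (by simp) (by simpa using nda)
    obtain ⟨y, hya, hyn, hy⟩ := h.exists_source hn (X := {d}) (v := a) (by simp)
      (by simpa using nda.symm)
    simp only [mem_singleton] at hxn hx hyn hy
    have nc : ∀ {s}, E d s → s ≠ c := by rintro s hs rfl; exact as _ _ hs hcd
    have nc' : ∀ {s}, E s a → s ≠ c := by rintro s hs rfl; exact as _ _ hs hac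
    refine h.not_nearly_disjoint (d := d) (a := a) (x := x) (y := y) (c := c) hM ?_ ?_ ?_ ?_ ?_
    · intro s h1 h2
      obtain rfl := hx s h1 h2
      exact hM x hdx h2
    · intro s h1 h2
      by_cases hyw : y = w
      · subst hyw
        refine h.noC6 d s y a b c nda ?_ (nc' hya) h1 h2 hya hab hbc hcd
        rintro rfl; exact hw ⟨h2, hya⟩
      · exact h.noC6 d s y a c w nda (nc h1) hyw h1 h2 hya hac hcw hwd
    · intro t h1 h2
      by_cases htw : t = w
      · subst htw
        refine h.noC6 d x t a b c nda ?_ (nc' h2) hdx h1 h2 hab hbc hcd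
        rintro rfl; exact hw ⟨h1, h2⟩
      · exact h.noC6 d x t a c w nda (nc hdx) htw hdx h1 h2 hac hcw hwd
    · intro s h1 h2
      obtain rfl := hy s h1 h2
      exact hM y h2 hya
    · intro t h1 h2
      by_contra ht
      exact h.noC6 d x t y a c (Ne.symm hyn) hxn ht hdx h1 h2 hya hac hcd

lemma SparseC6.not_chorded_of_empty (h : SparseC6 E) (hn : 10 ^ 9 ≤ Fintype.card V) {a b c d : V}
    (hab : E a b) (hbc : E b c) (hcd : E c d) (hda : E d a) (hac : E a c) (hbd : b ≠ d)
    (hM : ∀ s, E d s → ¬ E s a) : False := by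
  have hdb := h.edge_of_chorded hn hab hbc hcd hda hac hbd hM
  by_cases hN : ∃ w, E c w ∧ E w d
  · obtain ⟨w, hcw, hwd⟩ := hN
    exact h.false_of_chorded hn hab hbc hcd hda hac hM hdb hcw hwd
  · push Not at hN
    have : E b d := h.flip.edge_of_chorded hn (a := c) (b := b) (c := a) (d := d) hbc hab hda hcd
      hac hbd fun s h1 h2 => hN s h2 h1
    exact h.asymm _ _ hdb this

lemma SparseC6.not_chorded (h : SparseC6 E) (hn : 10 ^ 9 ≤ Fintype.card V) {a b c d : V}
    (hab : E a b) (hbc : E b c) (hcd : E c d) (hda : E d a) (hac : E a c) (hbd : b ≠ d) :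
    False := by
  by_cases hM : ∀ s, E d s → ¬ E s a
  · exact h.not_chorded_of_empty hn hab hbc hcd hda hac hbd hM
  push Not at hM
  obtain ⟨s, hds, hsa⟩ := hM
  refine h.flip.not_chorded_of_empty hn (a := c) (b := b) (c := a) (d := d) hbc hab hda hcd hac hbd
    fun w h1 h2 => ?_
  change E w d at h1
  change E c w at h2
  refine h.noC6 a b c w d s ?_ hbd ?_ hab hbc h2 h1 hds hsa
  · rintro rfl; exact h.asymm _ _ hac h2
  · rintro rfl; exact h.asymm _ _ hac hsa

end

/-- Every sufficiently large `C₆`-free oriented graph with minimum semidegree at least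
`n/4 + 1/2` contains no directed `4`-cycle with a chord. -/
theorem no_c4_with_chord :
    ∃ n₀ : ℕ, ∀ n : ℕ, n₀ ≤ n → ∀ E : Fin n → Fin n → Prop, Oriented E →
      (∀ v, (n : ℝ) / 4 + 1 / 2 ≤ (semiDeg E v : ℝ)) →
      ¬ HasDiCycle E 6 →
      ¬ ∃ a b c d : Fin n, a ≠ b ∧ a ≠ c ∧ a ≠ d ∧ b ≠ c ∧ b ≠ d ∧ c ≠ d ∧
        E a b ∧ E b c ∧ E c d ∧ E d a ∧ E a c := by
  refine ⟨10 ^ 9, fun n hn E hE hdeg hC => ?_⟩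
  rintro ⟨a, b, c, d, -, -, -, -, hbd, -, hab, hbc, hcd, hda, hac⟩
  have hout : ∀ v, outDeg E v = #(nbhd E v) := fun v => by
    rw [outDeg, ← Set.ncard_coe_finset]
    congr 1; ext w; simp [mem_nbhd]
  have hin : ∀ v, inDeg E v = #(nbhd (flip E) v) := fun v => by
    rw [inDeg, ← Set.ncard_coe_finset]
    congr 1; ext w; simp [mem_nbhd_flip]
  have h : SparseC6 E := by
    refine ⟨hE.2, ?_, fun v => ?_, fun v => ?_⟩
    · intro a b c d e f h1 h2 h3 e1 e2 e3 e4 e5 e6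
      refine hC ⟨(![a, b, c, d, e, f] : Fin 6 → Fin n), ?_, ?_⟩
      · have ir := hE.1
        have as := hE.2
        have : [a, b, c, d, e, f].Nodup := by
          simp only [List.nodup_cons, List.mem_cons, List.not_mem_nil, not_or]
          refine ⟨⟨?_, ?_, h1, ?_, ?_, not_false⟩, ⟨?_, ?_, h2, ?_, not_false⟩,
            ⟨?_, ?_, h3, not_false⟩, ⟨?_, ?_, not_false⟩, ⟨?_, not_false⟩, not_false,
            List.nodup_nil⟩ <;> grind
        exact List.nodup_ofFn.1 (by simpa [List.ofFn_succ] using this)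
      · intro i
        change Fin 6 at i
        fin_cases i <;> assumption
    · rw [Fintype.card_fin, ← hout]
      exact (hdeg v).trans (Nat.cast_le.2 (min_le_left _ _))
    · rw [Fintype.card_fin, ← hin]
      exact (hdeg v).trans (Nat.cast_le.2 (min_le_right _ _))
  exact h.not_chorded (by simpa using hn) hab hbc hcd hda hac hbd
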